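/- The copolar map sends nonempty members of C₋ exactly onto the members of C₊ other than R̄₊ⁿ: (i) for every nonempty A ∈ C₋, the copolar A° belongs to C₊ (it is closed, convex, contained in R̄₊ⁿ, and satisfies A° + R₊ⁿ ⊆ A°) and A° ≠ R̄₊ⁿ; (ii) conversely, for every B ∈ C₊ with B ≠ R̄₊ⁿ there exists a nonempty A ∈ C₋ with A° = B. -/

import Mathlib

open Set MeasureTheory Pointwise

noncomputable section

abbrev En (n : ℕ) := EuclideanSpace ℝ (Fin n)

/-- Standard inner product on ℝⁿ. -/
def dotp {n : ℕ} (x y : En n) : ℝ := ∑ i, x i * y i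

/-- Closed positive orthant R̄₊ⁿ. -/
def posOrthantCl (n : ℕ) : Set (En n) := {x | ∀ i, 0 ≤ x i}
/-- Open positive orthant R₊ⁿ. -/
def posOrthantOp (n : ℕ) : Set (En n) := {x | ∀ i, 0 < x i}
/-- Closed negative orthant R̄₋ⁿ. -/
def negOrthantCl (n : ℕ) : Set (En n) := {x | ∀ i, x i ≤ 0}
/-- Open negative orthant R₋ⁿ. -/
def negOrthantOp (n : ℕ) : Set (En n) := {x | ∀ i, x i < 0}

/-- Copolar A° = {x : ⟨x,y⟩ ≤ −1 for all y ∈ A}. -/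
def copolar {n : ℕ} (A : Set (En n)) : Set (En n) := {x | ∀ y ∈ A, dotp x y ≤ -1}

/-- Membership in C₊: closed convex subset of R̄₊ⁿ with A + R₊ⁿ ⊆ A. -/
def memCplus {n : ℕ} (A : Set (En n)) : Prop :=
  IsClosed A ∧ Convex ℝ A ∧ A ⊆ posOrthantCl n ∧ A + posOrthantOp n ⊆ A

/-- Membership in C₋: closed convex subset of R̄₋ⁿ with A + R₋ⁿ ⊆ A. -/
def memCminus {n : ℕ} (A : Set (En n)) : Prop :=
  IsClosed A ∧ Convex ℝ A ∧ A ⊆ negOrthantCl n ∧ A + negOrthantOp n ⊆ A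

/-- Membership in CC₊: member of C₊ with bounded complement in R̄₊ⁿ. -/
def memCCplus {n : ℕ} (P : Set (En n)) : Prop :=
  memCplus P ∧ Bornology.IsBounded (posOrthantCl n \ P)

/-- Membership in UC₋: nonempty member of C₋ contained in s* + R̄₋ⁿ for some s* ∈ R₋ⁿ. -/
def memUCminus {n : ℕ} (L : Set (En n)) : Prop :=
  L.Nonempty ∧ memCminus L ∧ ∃ s ∈ negOrthantOp n, L ⊆ s +ᵥ negOrthantCl n

/-- Support function of a set, with values in EReal. -/
def suppFn {n : ℕ} (A : Set (En n)) (x : En n) : EReal := ⨆ y ∈ A, ((dotp x y : ℝ) : EReal)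

/-- Legendre transform of an EReal-valued function. -/
def legendre {n : ℕ} (f : En n → EReal) (y : En n) : EReal :=
  ⨆ x, ((dotp x y : ℝ) : EReal) - f x
theorem dotp_eq_inner {n : ℕ} (x y : En n) : dotp x y = inner ℝ y x := by
  simp [dotp, PiLp.inner_apply]

theorem dotp_comm {n : ℕ} (x y : En n) : dotp x y = dotp y x := by
  simp [dotp, mul_comm]

theorem dotp_add_right {n : ℕ} (x y z : En n) : dotp x (y + z) = dotp x y + dotp x z := by
  simp [dotp_eq_inner, inner_add_left]

theorem dotp_smul_right {n : ℕ} (c : ℝ) (x y : En n) : dotp x (c • y) = c * dotp x y := by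
  simp [dotp_eq_inner, inner_smul_left]

theorem dotp_neg_right {n : ℕ} (x y : En n) : dotp x (-y) = -dotp x y := by
  simp [dotp_eq_inner]

theorem dotp_neg_left {n : ℕ} (x y : En n) : dotp (-x) y = -dotp x y := by
  simp [dotp_eq_inner]

theorem dotp_nonpos {n : ℕ} {x y : En n} (hx : x ∈ posOrthantCl n) (hy : y ∈ negOrthantCl n) :
    dotp x y ≤ 0 :=
  Finset.sum_nonpos fun i _ => mul_nonpos_of_nonneg_of_nonpos (hx i) (hy i)

theorem posOrthantOp_subset (n : ℕ) : posOrthantOp n ⊆ posOrthantCl n :=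
  fun _ hx i => (hx i).le

theorem negOrthantOp_subset (n : ℕ) : negOrthantOp n ⊆ negOrthantCl n :=
  fun _ hx i => (hx i).le

theorem isClosed_copolar {n : ℕ} (A : Set (En n)) : IsClosed (copolar A) := by
  simp only [copolar, ofPred_forall, dotp_eq_inner]
  exact isClosed_biInter fun y _ => isClosed_le (by fun_prop) continuous_const

theorem convex_copolar {n : ℕ} (A : Set (En n)) : Convex ℝ (copolar A) := by
  intro x hx z hz a b ha hb hab y hy
  have h1 := mul_le_mul_of_nonneg_left (hx y hy) ha
  have h2 := mul_le_mul_of_nonneg_left (hz y hy) hb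
  rw [dotp_comm, dotp_add_right, dotp_smul_right, dotp_smul_right, dotp_comm y, dotp_comm y]
  linarith

theorem isClosed_negOrthantCl (n : ℕ) : IsClosed (negOrthantCl n) := by
  simp only [negOrthantCl, ofPred_forall]
  exact isClosed_iInter fun i => isClosed_le (by fun_prop) continuous_const

theorem convex_negOrthantCl (n : ℕ) : Convex ℝ (negOrthantCl n) := by
  intro x hx y hy a b ha hb _ i
  have h1 := mul_nonpos_of_nonneg_of_nonpos ha (hx i)
  have h2 := mul_nonpos_of_nonneg_of_nonpos hb (hy i)
  simpa using add_nonpos h1 h2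

/-- A linear functional bounded above on a translate of the negative orthant is nonnegative. -/
theorem mem_posOrthantCl_of_dotp_le {n : ℕ} {x a : En n} {c : ℝ}
    (h : ∀ s ∈ negOrthantOp n, dotp x (a + s) ≤ c) : x ∈ posOrthantCl n := by
  intro i
  by_contra! hi
  set d : ℝ := |c - dotp x a + ∑ j, x j| + 1
  have hd : 0 < d := by positivity
  set t : ℝ := d / (-x i)
  have ht : 0 < t := div_pos hd (by linarith)
  have htx : x i * t = -d := by
    rw [← neg_neg (x i * t), ← neg_mul, mul_div_cancel₀ d (neg_pos.2 hi).ne']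
  let s : En n := WithLp.toLp 2 fun j => -1 - if j = i then t else 0
  have hs : s ∈ negOrthantOp n := by
    intro j
    simp only [s]
    split_ifs <;> linarith
  have hxs : dotp x s = -∑ j, x j + d := by
    simp [dotp, s, mul_sub, Finset.sum_sub_distrib, htx]
  have := h s hs
  rw [dotp_add_right, hxs] at this
  have := le_abs_self (c - dotp x a + ∑ j, x j)
  simp only [d] at *
  linarith

/-- A linear functional bounded above on a translate of the positive orthant is nonpositive. -/
theorem mem_negOrthantCl_of_dotp_le {n : ℕ} {x a : En n} {c : ℝ}
    (h : ∀ s ∈ posOrthantOp n, dotp x (a + s) ≤ c) : x ∈ negOrthantCl n := by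
  have hneg : -x ∈ posOrthantCl n := by
    refine mem_posOrthantCl_of_dotp_le (a := -a) (c := c) fun s hs => ?_
    have h1 := h (-s) fun i => by simpa using hs i
    rwa [← neg_neg (a + -s), dotp_neg_right, ← dotp_neg_left, neg_add, neg_neg] at h1
  intro i
  simpa using hneg i

theorem copolar_subset_posOrthantCl {n : ℕ} {A : Set (En n)} (hA : memCminus A)
    (hne : A.Nonempty) : copolar A ⊆ posOrthantCl n := by
  obtain ⟨a, ha⟩ := hne
  exact fun x hx => mem_posOrthantCl_of_dotp_le fun s hs =>
    hx _ (hA.2.2.2 (add_mem_add ha hs))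

theorem memCplus_copolar {n : ℕ} {A : Set (En n)} (hA : memCminus A) (hne : A.Nonempty) :
    memCplus (copolar A) := by
  refine ⟨isClosed_copolar A, convex_copolar A, copolar_subset_posOrthantCl hA hne, ?_⟩
  rintro _ ⟨x, hx, p, hp, rfl⟩ y hy
  have h1 := hx y hy
  have h2 := dotp_nonpos (posOrthantOp_subset n hp) (hA.2.2.1 hy)
  simp only [dotp_comm _ y, dotp_add_right] at *
  linarith

theorem copolar_ne_posOrthantCl {n : ℕ} {A : Set (En n)} (hne : A.Nonempty) :
    copolar A ≠ posOrthantCl n := by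
  intro h
  obtain ⟨a, ha⟩ := hne
  have h0 : (0 : En n) ∈ copolar A := h ▸ fun i => le_rfl
  have := h0 a ha
  norm_num [dotp] at this

theorem memCminus_copolar_inter {n : ℕ} {B : Set (En n)} (hB : B ⊆ posOrthantCl n) :
    memCminus (copolar B ∩ negOrthantCl n) := by
  refine ⟨(isClosed_copolar B).inter (isClosed_negOrthantCl n),
    (convex_copolar B).inter (convex_negOrthantCl n), inter_subset_right, ?_⟩
  rintro _ ⟨y, ⟨hy, hy'⟩, s, hs, rfl⟩
  refine ⟨fun b hb => ?_, fun i => add_nonpos (hy' i) (hs i).le⟩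
  have h1 := hy b hb
  have h2 := dotp_nonpos (hB hb) (negOrthantOp_subset n hs)
  simp only [dotp_comm _ b, dotp_add_right] at *
  linarith

theorem exists_mem_copolar_inter_lt_dotp {n : ℕ} {B : Set (En n)} (hB : memCplus B) {x : En n}
    (hx : x ∈ posOrthantCl n) (hxB : x ∉ B) :
    ∃ y ∈ copolar B ∩ negOrthantCl n, -1 < dotp x y := by
  obtain rfl | ⟨b₀, hb₀⟩ := B.eq_empty_or_nonempty
  · exact ⟨0, ⟨by simp [copolar], fun i => le_rfl⟩, by norm_num [dotp]⟩
  obtain ⟨f, c, hf, hc⟩ := geometric_hahn_banach_closed_point hB.2.1 hB.1 hxB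
  set v : En n := (InnerProductSpace.toDual ℝ (En n)).symm f
  have hv : ∀ z, f z = dotp z v := fun z => by
    rw [dotp_eq_inner, InnerProductSpace.toDual_symm_apply]
  simp only [hv] at hf hc
  have hvneg : v ∈ negOrthantCl n := mem_negOrthantCl_of_dotp_le (a := b₀) (c := c) fun s hs => by
    rw [dotp_comm]
    exact (hf _ (hB.2.2.2 (add_mem_add hb₀ hs))).le
  have hc0 : 0 < -c := by linarith [dotp_nonpos hx hvneg]
  have hcinv : 0 < (-c)⁻¹ := inv_pos.2 hc0
  have hcc : (-c)⁻¹ * c = -1 := by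
    have : c ≠ 0 := by linarith
    field_simp
  refine ⟨(-c)⁻¹ • v, ⟨fun b hb => ?_, fun i => ?_⟩, ?_⟩
  · rw [dotp_comm, dotp_smul_right, ← hcc]
    exact mul_le_mul_of_nonneg_left (hf b hb).le hcinv.le
  · simpa using mul_nonpos_of_nonneg_of_nonpos hcinv.le (hvneg i)
  · rw [dotp_smul_right, ← hcc]
    exact mul_lt_mul_of_pos_left hc hcinv

/-- The copolar map sends nonempty members of C₋ exactly onto the members
of C₊ other than R̄₊ⁿ. -/
theorem copolar_image_Cminus (n : ℕ) (hn : 1 ≤ n) :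
    (∀ A : Set (En n), memCminus A → A.Nonempty →
      memCplus (copolar A) ∧ copolar A ≠ posOrthantCl n) ∧
    (∀ B : Set (En n), memCplus B → B ≠ posOrthantCl n →
      ∃ A : Set (En n), memCminus A ∧ A.Nonempty ∧ copolar A = B) := by
  refine ⟨fun A hA hne => ⟨memCplus_copolar hA hne, copolar_ne_posOrthantCl hne⟩,
    fun B hB hne => ?_⟩
  have hA := memCminus_copolar_inter hB.2.2.1
  have hAne : (copolar B ∩ negOrthantCl n).Nonempty := by
    obtain ⟨x, hx, hxB⟩ := not_subset.1 fun h => hne (hB.2.2.1.antisymm h)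
    obtain ⟨y, hy, _⟩ := exists_mem_copolar_inter_lt_dotp hB hx hxB
    exact ⟨y, hy⟩
  refine ⟨_, hA, hAne, Subset.antisymm (fun x hx => ?_) fun b hb y hy => ?_⟩
  · by_contra hxB
    obtain ⟨y, hy, hlt⟩ :=
      exists_mem_copolar_inter_lt_dotp hB (copolar_subset_posOrthantCl hA hAne hx) hxB
    exact (hx y hy).not_gt hlt
  · rw [dotp_comm]
    exact hy.1 b hb
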